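/- Let k ≥ 60 and let d be a real number with 2^k·ln 2 − (1 + ln 2) ≤ d ≤ 2^k·ln 2. Let 0 < α ≤ 1/√k with αn a positive integer. Draw a formula φ as follows: the number of clauses m is Poisson with mean d·n and, given m, the m clauses are i.i.d. uniform over all (2n)^k clauses; condition on φ being satisfiable. Independently, draw a sequence of ⌈2n^2·2^n/C(n, αn)⌉ assignments i.i.d. uniformly from {0,1}^n. Then with probability at least 1 − e^{−n/(3·ln(2)·2^k)} − 3·e^{−(1−α)^{2k}·ln(2)·n/32}, some assignment h in the sequence simultaneously (a) has Hamming distance at most αn from some satisfying assignment of φ, and (b) satisfies NumClausesSAT(φ, h) ≥ (1 − (1−(1−α)^{2k})/(2^k−1))·m. -/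

import Mathlib

open scoped Classical
open Finset

/-- An assignment of `n` Boolean variables. -/
abbrev Assignment (n : ℕ) := Fin n → Bool

/-- A clause: an ordered `k`-tuple of literals, each a variable index together with a sign. -/
abbrev Clause (n k : ℕ) := Fin k → Fin n × Bool

/-- A formula: an ordered `m`-tuple of clauses. -/
abbrev Formula (n k m : ℕ) := Fin m → Clause n k

/-- An assignment satisfies a clause if it satisfies at least one literal of the clause. -/
def SatClause {n k : ℕ} (v : Assignment n) (c : Clause n k) : Prop :=
  ∃ i, v (c i).1 = (c i).2

/-- An assignment satisfies a formula if it satisfies every clause. -/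
def SatFormula {n k m : ℕ} (v : Assignment n) (φ : Formula n k m) : Prop :=
  ∀ j, SatClause v (φ j)

/-- The number of clauses of `φ` satisfied by `v`. -/
noncomputable def numSat {n k m : ℕ} (φ : Formula n k m) (v : Assignment n) : ℕ :=
  (Finset.univ.filter fun j => SatClause v (φ j)).card

/-- The number of clauses of `φ` left unsatisfied by `v`. -/
noncomputable def numUnsat {n k m : ℕ} (φ : Formula n k m) (v : Assignment n) : ℕ :=
  (Finset.univ.filter fun j => ¬ SatClause v (φ j)).card

lemma card_unsat_both {n k : ℕ} (v w : Assignment n) :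
    ((univ : Finset (Clause n k)).filter fun c => ¬ SatClause v c ∧ ¬ SatClause w c).card
      = (n - hammingDist v w) ^ k := by
  have h1 : ((univ : Finset (Clause n k)).filter fun c => ¬ SatClause v c ∧ ¬ SatClause w c)
      = Fintype.piFinset (fun _ => (univ : Finset (Fin n × Bool)).filter
          fun l => v l.1 ≠ l.2 ∧ w l.1 ≠ l.2) := by
    ext c
    simp only [SatClause, mem_filter, mem_univ, true_and, Fintype.mem_piFinset, not_exists]
    exact ⟨fun h i => ⟨h.1 i, h.2 i⟩, fun h => ⟨fun i => (h i).1, fun i => (h i).2⟩⟩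
  rw [h1, Fintype.card_piFinset_const]
  congr 1
  have h2 : ((univ : Finset (Fin n × Bool)).filter fun l => v l.1 ≠ l.2 ∧ w l.1 ≠ l.2)
      = ((univ : Finset (Fin n)).filter fun i => v i = w i).image fun i => (i, !v i) := by
    ext ⟨i, b⟩
    simp only [mem_filter, mem_univ, true_and, mem_image, Prod.mk.injEq]
    constructor
    · rintro ⟨h, h'⟩
      refine ⟨i, ?_, rfl, ?_⟩
      · revert h h'; cases v i <;> cases w i <;> cases b <;> simp
      · revert h; cases v i <;> cases b <;> simp
    · rintro ⟨j, hj, rfl, rfl⟩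
      rw [← hj]; simp
  rw [h2, card_image_of_injective]
  · have := Finset.card_filter_add_card_filter_not (s := (univ : Finset (Fin n)))
      (fun i => v i = w i)
    rw [card_univ, Fintype.card_fin] at this
    have h3 : hammingDist v w = ((univ : Finset (Fin n)).filter fun i => ¬ v i = w i).card := by
      unfold hammingDist
      congr 1
    omega
  · intro i j h
    exact (Prod.mk.inj h).1

lemma card_unsat {n k : ℕ} (v : Assignment n) :
    ((univ : Finset (Clause n k)).filter fun c => ¬ SatClause v c).card = n ^ k := by
  have := card_unsat_both (k := k) v v
  simpa using this

lemma card_clause {n k : ℕ} : Fintype.card (Clause n k) = (2 * n) ^ k := by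
  simp [Clause, mul_comm]

lemma card_sat {n k : ℕ} (v : Assignment n) :
    (((univ : Finset (Clause n k)).filter fun c => SatClause v c).card : ℝ)
      = (2 * n) ^ k - n ^ k := by
  have := Finset.card_filter_add_card_filter_not (s := (univ : Finset (Clause n k)))
      (fun c => SatClause v c)
  rw [card_unsat, card_univ, card_clause] at this
  have h : ((_ + _ : ℕ) : ℝ) = ((_ : ℕ) : ℝ) := congrArg _ this
  push_cast at h
  linarith

lemma card_sat_unsat {n k : ℕ} (a h : Assignment n) :
    (((univ : Finset (Clause n k)).filter fun c => SatClause a c ∧ ¬ SatClause h c).card : ℝ)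
      = n ^ k - ((n - hammingDist a h : ℕ) : ℝ) ^ k := by
  have := Finset.card_filter_add_card_filter_not
      (s := (univ : Finset (Clause n k)).filter fun c => ¬ SatClause h c)
      (fun c => SatClause a c)
  rw [filter_filter, filter_filter, card_unsat] at this
  have h1 := card_unsat_both (k := k) a h
  simp only [and_comm] at this h1 ⊢
  rw [h1] at this
  have h : ((_ + _ : ℕ) : ℝ) = ((_ : ℕ) : ℝ) := congrArg _ this
  push_cast at h
  linarith

lemma card_sat_both {n k : ℕ} (a b : Assignment n) :
    (((univ : Finset (Clause n k)).filter fun c => SatClause a c ∧ SatClause b c).card : ℝ)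
      = (2 * n) ^ k - 2 * n ^ k + ((n - hammingDist a b : ℕ) : ℝ) ^ k := by
  have := Finset.card_filter_add_card_filter_not
      (s := (univ : Finset (Clause n k)).filter fun c => SatClause a c)
      (fun c => SatClause b c)
  rw [filter_filter, filter_filter] at this
  have h : ((_ + _ : ℕ) : ℝ) = ((_ : ℕ) : ℝ) := congrArg _ this
  push_cast at h
  rw [card_sat, card_sat_unsat] at h
  linarith

/-- flip the coordinates in `s`. -/
def flipOn {n : ℕ} (a : Assignment n) (s : Finset (Fin n)) : Assignment n :=
  fun i => if i ∈ s then !a i else a i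

lemma flipOn_ne {n : ℕ} (a : Assignment n) (s : Finset (Fin n)) (i : Fin n) :
    a i ≠ flipOn a s i ↔ i ∈ s := by
  unfold flipOn; split_ifs with h <;> simp [h]

/-- the set where `a` and `h` differ. -/
def diffSet {n : ℕ} (a h : Assignment n) : Finset (Fin n) := univ.filter fun i => a i ≠ h i

lemma diffSet_card {n : ℕ} (a h : Assignment n) : (diffSet a h).card = hammingDist a h := by
  unfold diffSet hammingDist
  congr 1

/-- assignments versus sets of flipped coordinates. -/
def flipEquiv {n : ℕ} (a : Assignment n) : Finset (Fin n) ≃ Assignment n where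
  toFun := flipOn a
  invFun := diffSet a
  left_inv s := by ext i; simp [diffSet, flipOn_ne]
  right_inv h := by
    ext i
    unfold flipOn diffSet
    by_cases hh : a i = h i
    · simp [hh]
    · simp [hh]; revert hh; cases a i <;> cases h i <;> simp

lemma dist_flip {n : ℕ} (a : Assignment n) (s : Finset (Fin n)) :
    hammingDist a (flipEquiv a s) = s.card := by
  rw [← diffSet_card]
  exact congrArg _ ((flipEquiv a).left_inv s)

lemma sum_dist {n : ℕ} (a : Assignment n) (F : ℕ → ℝ) :
    ∑ b : Assignment n, F (hammingDist a b) = ∑ j ∈ range (n + 1), (n.choose j : ℝ) * F j := by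
  rw [← Equiv.sum_comp (flipEquiv a)]
  simp only [dist_flip]
  rw [← Finset.powerset_univ, Finset.sum_powerset_apply_card]
  simp

lemma card_sphere {n : ℕ} (a : Assignment n) (t : ℕ) :
    ((univ : Finset (Assignment n)).filter fun h => hammingDist a h = t).card = n.choose t := by
  have : ((univ : Finset (Assignment n)).filter fun h => hammingDist a h = t)
      = ((univ : Finset (Fin n)).powersetCard t).map (flipEquiv a).toEmbedding := by
    ext h
    obtain ⟨s, rfl⟩ := (flipEquiv a).surjective h
    simp [dist_flip, mem_powersetCard]
  rw [this, card_map, card_powersetCard]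
  simp

lemma card_sphere_diff {n : ℕ} (a : Assignment n) (t : ℕ) (x : Fin n) :
    (n : ℝ) * ((univ : Finset (Assignment n)).filter
      fun h => hammingDist a h = t ∧ a x ≠ h x).card = t * n.choose t := by
  have h1 : ((univ : Finset (Assignment n)).filter fun h => hammingDist a h = t ∧ ¬ a x ≠ h x)
      = ((univ.erase x : Finset (Fin n)).powersetCard t).map (flipEquiv a).toEmbedding := by
    ext h
    obtain ⟨s, rfl⟩ := (flipEquiv a).surjective h
    simp only [mem_filter, mem_univ, true_and, dist_flip, mem_map_equiv, Equiv.symm_apply_apply,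
      mem_powersetCard]
    have : a x ≠ flipEquiv a s x ↔ x ∈ s := flipOn_ne a s x
    rw [this, Finset.subset_erase]
    simp [and_comm]
  have h2 := Finset.card_filter_add_card_filter_not
      (s := (univ : Finset (Assignment n)).filter fun h => hammingDist a h = t)
      (fun h => a x ≠ h x)
  rw [filter_filter, filter_filter, h1, card_map, card_powersetCard, card_sphere,
    card_erase_of_mem (mem_univ _), card_univ, Fintype.card_fin] at h2
  obtain ⟨n', rfl⟩ : ∃ n', n = n' + 1 := ⟨n - 1, by have := x.pos; omega⟩
  rw [Nat.add_sub_cancel] at h2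
  rcases t with _ | t
  · simp at h2 ⊢
  · have h3 := Nat.add_one_mul_choose_eq n' t
    rw [Nat.choose_succ_succ'] at h2
    have h4 : ((univ : Finset (Assignment (n' + 1))).filter
      fun h => hammingDist a h = t + 1 ∧ a x ≠ h x).card = n'.choose t := by omega
    rw [h4]
    have h : ((_ * _ : ℕ) : ℝ) = ((_ * _ : ℕ) : ℝ) := congrArg _ h3
    push_cast at h ⊢
    linarith

/-- Poisson generating function. -/
lemma pois_hasSum (c x : ℝ) :
    HasSum (fun m : ℕ => Real.exp (-c) * c ^ m / (Nat.factorial m) * x ^ m)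
      (Real.exp (-(c * (1 - x)))) := by
  have h := (NormedSpace.expSeries_div_hasSum_exp (𝔸 := ℝ) (c * x)).mul_left (Real.exp (-c))
  rw [← Real.exp_eq_exp_ℝ, ← Real.exp_add] at h
  have e1 : (fun m : ℕ => Real.exp (-c) * c ^ m / (Nat.factorial m) * x ^ m)
      = fun m : ℕ => Real.exp (-c) * ((c * x) ^ m / (Nat.factorial m)) := by
    funext m; rw [mul_pow]; ring
  have e2 : -(c * (1 - x)) = -c + c * x := by ring
  rw [e1, e2]
  exact h

lemma sq_q (k : ℕ) : (Real.sqrt ((1/2:ℝ)^k)) ^ 2 = (1/2:ℝ)^k := Real.sq_sqrt (by positivity)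

/-- `2^{-k/2}` written with `exp`. -/
lemma q_exp (k : ℕ) : Real.sqrt ((1/2:ℝ)^k) = Real.exp (-(Real.log 2 * k / 2)) := by
  have h2 : (1/2:ℝ)^k = Real.exp (-(Real.log 2 * k / 2)) ^ 2 := by
    rw [← Real.exp_nat_mul]
    have : (1/2:ℝ) = Real.exp (-Real.log 2) := by
      rw [Real.exp_neg, Real.exp_log (by norm_num)]; norm_num
    rw [this, ← Real.exp_nat_mul]
    congr 1; push_cast; ring
  rw [h2, Real.sqrt_sq (by positivity)]

lemma exp_neg_half {y : ℝ} (h0 : 0 ≤ y) (h1 : y ≤ 1) : Real.exp (-y) ≤ 1 - y / 2 := by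
  have h := Real.abs_exp_sub_one_sub_id_le (x := -y) (by rw [abs_neg, abs_of_nonneg h0]; exact h1)
  have h2 := (abs_le.mp h).2
  have h3 := Real.exp_bound_div_one_sub_of_interval (x := y)
  have h5 : 1 + y + y ^ 2 / 2 ≤ Real.exp y := Real.quadratic_le_exp_of_nonneg h0
  rw [Real.exp_neg]
  rw [inv_le_comm₀ (Real.exp_pos _) (by linarith)]
  refine le_trans ?_ h5
  rw [inv_le_iff_one_le_mul₀ (by linarith)]
  nlinarith [mul_nonneg h0 (sub_nonneg.2 h1), mul_nonneg h0 h0, mul_nonneg (mul_nonneg h0 h0) (sub_nonneg.2 h1)]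

lemma exp_le_one_of_pow {x : ℝ} (n : ℕ) (h0 : 0 ≤ x) (h : x ≤ 1) : x ^ n ≤ 1 :=
  pow_le_one₀ h0 h

lemma gen_sum (n : ℕ) (x : ℝ) :
    ∑ j ∈ range (n + 1), (n.choose j : ℝ) * x ^ j = (1 + x) ^ n := by
  rw [add_comm 1 x, add_pow]
  refine sum_congr rfl fun j _ => ?_
  simp; ring

/-- the pointwise bound in the second moment. -/
lemma second_pointwise (n k j : ℕ) (hn : 0 < n) (hk : 60 ≤ k) (hj : j ≤ n) :
    Real.exp (Real.log 2 * n * ((1 - (j:ℝ) / n) ^ k - 1))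
      ≤ (Real.sqrt ((1/2:ℝ)^k)) ^ j
        + Real.exp (-(Real.log 2 * n * (1/5))) * (1/8) ^ j
        + Real.exp (-(Real.log 2 * n * (3/5))) * (1/2) ^ j
        + Real.exp (n * Real.sqrt ((1/2:ℝ)^k)) * (1/2) ^ n := by
  set L := Real.log 2 with hL
  have hL0 : 0 < L := Real.log_pos (by norm_num)
  have hL1 : L ≤ 1 := by
    have := Real.log_two_lt_d9; rw [← hL] at this; linarith
  have hn' : (0:ℝ) < n := by exact_mod_cast hn
  have hk' : (60:ℝ) ≤ k := by exact_mod_cast hk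
  set β : ℝ := (j:ℝ) / n with hβ
  have hjn : (j:ℝ) = β * n := by rw [hβ]; field_simp
  have hβ0 : 0 ≤ β := by positivity
  have hβ1 : β ≤ 1 := by
    rw [hβ, div_le_one hn']; exact_mod_cast hj
  have e2 : ∀ r : ℕ, ((1/2:ℝ))^r = Real.exp (-(L * r)) := by
    intro r
    have : (1/2:ℝ) = Real.exp (-Real.log 2) := by
      rw [Real.exp_neg, Real.exp_log (by norm_num)]; norm_num
    rw [this, ← Real.exp_nat_mul]
    congr 1; ring
  have e8 : ((1/8:ℝ))^j = Real.exp (-(3 * L * j)) := by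
    have := e2 (3 * j)
    rw [pow_mul] at this
    norm_num at this ⊢
    rw [this]; congr 1; ring
  have hexp : (1 - β) ^ k ≤ Real.exp (-(k * β)) := by
    have := Real.one_sub_le_exp_neg β
    calc (1 - β) ^ k ≤ (Real.exp (-β)) ^ k := pow_le_pow_left₀ (by linarith) this k
      _ = _ := by rw [← Real.exp_nat_mul]; congr 1; ring
  have p1 : 0 ≤ (Real.sqrt ((1/2:ℝ)^k)) ^ j := by positivity
  have p2 : 0 ≤ Real.exp (-(L * n * (1/5))) * (1/8) ^ j := by positivity
  have p3 : 0 ≤ Real.exp (-(L * n * (3/5))) * (1/2) ^ j := by positivity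
  have p4 : 0 ≤ Real.exp (n * Real.sqrt ((1/2:ℝ)^k)) * (1/2) ^ n := by positivity
  rcases le_total (k * β) 1 with hA | hA
  · have : Real.exp (L * n * ((1 - β) ^ k - 1)) ≤ (Real.sqrt ((1/2:ℝ)^k)) ^ j := by
      rw [q_exp, ← Real.exp_nat_mul]
      apply Real.exp_le_exp.2
      have h := exp_neg_half (by positivity) hA
      rw [← hL, hjn]
      have : (1 - β) ^ k - 1 ≤ - (k * β) / 2 := by linarith
      have := mul_le_mul_of_nonneg_left this (by positivity : 0 ≤ L * n)
      linarith
    linarith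
  · rcases le_total β (1/10) with hB | hB
    · have : Real.exp (L * n * ((1 - β) ^ k - 1)) ≤
          Real.exp (-(L * n * (1/5))) * (1/8) ^ j := by
        rw [e8, ← Real.exp_add]
        apply Real.exp_le_exp.2
        have h := exp_neg_half (y := 1) (by norm_num) le_rfl
        have h' : Real.exp (-(k * β)) ≤ Real.exp (-1) := Real.exp_le_exp.2 (by linarith)
        have : (1 - β) ^ k - 1 ≤ - (1/5) - 3 * β := by linarith
        have := mul_le_mul_of_nonneg_left this (by positivity : 0 ≤ L * n)
        rw [hjn]; linarith
      linarith
    · have hpow : (1 - β) ^ k ≤ 1 / 10 := by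
        calc (1 - β) ^ k ≤ (9/10) ^ k := pow_le_pow_left₀ (by linarith) (by linarith) k
          _ ≤ (9/10) ^ 60 := pow_le_pow_of_le_one (by norm_num) (by norm_num) hk
          _ ≤ 1/10 := by norm_num
      rcases le_total β (3/10) with hC | hC
      · have : Real.exp (L * n * ((1 - β) ^ k - 1)) ≤
          Real.exp (-(L * n * (3/5))) * (1/2) ^ j := by
          rw [e2, ← Real.exp_add]
          apply Real.exp_le_exp.2
          have : (1 - β) ^ k - 1 ≤ - (3/5) - β := by linarith
          have := mul_le_mul_of_nonneg_left this (by positivity : 0 ≤ L * n)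
          rw [hjn]; linarith
        linarith
      · have : Real.exp (L * n * ((1 - β) ^ k - 1)) ≤
          Real.exp (n * Real.sqrt ((1/2:ℝ)^k)) * (1/2) ^ n := by
          rw [e2 n, ← Real.exp_add]
          apply Real.exp_le_exp.2
          have hq : (1 - β) ^ k ≤ Real.sqrt ((1/2:ℝ)^k) := by
            apply Real.le_sqrt_of_sq_le
            rw [← pow_mul, mul_comm, pow_mul]
            apply pow_le_pow_left₀ (by positivity)
            nlinarith
          have : L * ((1 - β) ^ k) ≤ Real.sqrt ((1/2:ℝ)^k) := by
            have : 0 ≤ (1-β)^k := pow_nonneg (by linarith) k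
            nlinarith
          have := mul_le_mul_of_nonneg_left this hn'.le
          linarith
        linarith

lemma second_sum (n k : ℕ) (hn : 0 < n) (hk : 60 ≤ k) :
    ∑ j ∈ range (n + 1), (n.choose j : ℝ) *
        Real.exp (Real.log 2 * n * ((1 - (j:ℝ) / n) ^ k - 1))
      ≤ 4 * Real.exp (n * Real.sqrt ((1/2:ℝ)^k)) := by
  set q := Real.sqrt ((1/2:ℝ)^k) with hq
  have hq0 : 0 ≤ q := Real.sqrt_nonneg _
  have e5 : ∀ r : ℕ, Real.exp (-(Real.log 2 * n * (r/5))) = (Real.exp (-(Real.log 2 * (r / 5)))) ^ n := by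
    intro r; rw [← Real.exp_nat_mul]; congr 1; ring
  have f5 : ∀ r : ℕ, Real.exp (-(Real.log 2 * (r / 5))) ^ 5 = (1/2)^r := by
    intro r
    have : (1/2:ℝ) = Real.exp (-Real.log 2) := by
      rw [Real.exp_neg, Real.exp_log (by norm_num)]; norm_num
    rw [this, ← Real.exp_nat_mul, ← Real.exp_nat_mul]
    congr 1; push_cast; ring
  have hE : 1 ≤ Real.exp (n * q) := Real.one_le_exp (by positivity)
  have key : ∀ (r : ℕ) (x : ℝ), 0 ≤ x → (1 + x) ^ 5 * (1/2)^r ≤ 1 →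
      Real.exp (-(Real.log 2 * n * (r/5))) * (1 + x) ^ n ≤ 1 := by
    intro r x hx h
    rw [e5, ← mul_pow]
    apply pow_le_one₀ (by positivity)
    have : (Real.exp (-(Real.log 2 * (r / 5))) * (1 + x)) ^ 5 ≤ 1 ^ 5 := by
      rw [mul_pow, f5]; linarith
    exact le_of_pow_le_pow_left₀ (by norm_num) (by norm_num) this
  calc _ ≤ ∑ j ∈ range (n + 1), (n.choose j : ℝ) * (q ^ j
        + Real.exp (-(Real.log 2 * n * (1/5))) * (1/8) ^ j
        + Real.exp (-(Real.log 2 * n * (3/5))) * (1/2) ^ j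
        + Real.exp (n * q) * (1/2) ^ n) := by
        apply sum_le_sum
        intro j hj
        apply mul_le_mul_of_nonneg_left _ (by positivity)
        exact second_pointwise n k j hn hk (by simpa [Nat.lt_succ_iff] using hj)
    _ = (1 + q) ^ n + Real.exp (-(Real.log 2 * n * (1/5))) * (1 + 1/8) ^ n
        + Real.exp (-(Real.log 2 * n * (3/5))) * (1 + 1/2) ^ n
        + Real.exp (n * q) * (1/2) ^ n * (1 + 1) ^ n := by
        rw [← gen_sum n q, ← gen_sum n (1/8), ← gen_sum n (1/2), ← gen_sum n 1]
        simp only [mul_sum, ← sum_add_distrib]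
        refine sum_congr rfl fun j _ => ?_
        simp only [one_pow]; ring
    _ ≤ Real.exp (n * q) + 1 + 1 + Real.exp (n * q) := by
        have h1 : (1 + q) ^ n ≤ Real.exp (n * q) := by
          rw [Real.exp_nat_mul]
          apply pow_le_pow_left₀ (by positivity)
          linarith [Real.add_one_le_exp q]
        have h2 := key 1 (1/8) (by norm_num) (by norm_num)
        have h3 := key 3 (1/2) (by norm_num) (by norm_num)
        push_cast at h2 h3
        have h4 : Real.exp (n * q) * (1/2) ^ n * (1 + 1) ^ n = Real.exp (n * q) := by
          rw [mul_assoc, ← mul_pow]; norm_num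
        linarith
    _ ≤ _ := by linarith

lemma card_forall {n k m : ℕ} (P : Clause n k → Prop) (Q : Formula n k m → Prop)
    [DecidablePred Q] (hQ : ∀ φ, Q φ ↔ ∀ j, P (φ j)) :
    ((univ : Finset (Formula n k m)).filter fun φ => Q φ).card
      = ((univ : Finset (Clause n k)).filter fun c => P c).card ^ m := by
  have h1 : ((univ : Finset (Formula n k m)).filter fun φ => Q φ)
      = Fintype.piFinset (fun _ => (univ : Finset (Clause n k)).filter fun c => P c) := by
    ext c
    simp [Fintype.mem_piFinset, hQ]
  rw [h1, Fintype.card_piFinset_const]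

lemma second_moment_count {n k m : ℕ} (l : ℝ) :
    2 * l * (2 ^ n * ((2 * (n:ℝ)) ^ k - n ^ k) ^ m)
      - l ^ 2 * (2 ^ n * ∑ j ∈ range (n + 1), (n.choose j : ℝ) *
          ((2 * (n:ℝ)) ^ k - 2 * n ^ k + ((n - j : ℕ) : ℝ) ^ k) ^ m)
    ≤ (((univ : Finset (Formula n k m)).filter fun φ =>
              ∃ a : Assignment n, SatFormula a φ).card : ℝ) := by
  have h1 : ∀ a : Assignment n, ∑ φ : Formula n k m, (if SatFormula a φ then (1:ℝ) else 0)
      = ((2 * (n:ℝ)) ^ k - n ^ k) ^ m := by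
    intro a
    rw [Finset.sum_boole, ← card_sat a]
    have := card_forall (m := m) (fun c : Clause n k => SatClause a c) (fun φ => SatFormula a φ)
      (fun φ => Iff.rfl)
    exact_mod_cast this
  have h2 : ∀ a b : Assignment n, ∑ φ : Formula n k m, (if SatFormula a φ then (1:ℝ) else 0) *
      (if SatFormula b φ then (1:ℝ) else 0)
      = ((2 * (n:ℝ)) ^ k - 2 * n ^ k + ((n - hammingDist a b : ℕ) : ℝ) ^ k) ^ m := by
    intro a b
    rw [← card_sat_both a b]
    have := card_forall (m := m) (fun c : Clause n k => SatClause a c ∧ SatClause b c)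
      (fun φ => SatFormula a φ ∧ SatFormula b φ) (fun φ => forall_and.symm)
    have h3 : ∀ φ : Formula n k m, (if SatFormula a φ then (1:ℝ) else 0) *
      (if SatFormula b φ then (1:ℝ) else 0) =
      if SatFormula a φ ∧ SatFormula b φ then 1 else 0 := by
      intro φ
      by_cases ha : SatFormula a φ <;> by_cases hb : SatFormula b φ <;> simp [ha, hb]
    simp only [h3]
    rw [Finset.sum_boole, ← Nat.cast_pow]
    refine congrArg _ ?_
    convert this
  set Z : Formula n k m → ℝ := fun φ => ∑ a, (if SatFormula a φ then (1:ℝ) else 0) with hZ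
  have e1 : ∑ φ, Z φ = 2 ^ n * ((2 * (n:ℝ)) ^ k - n ^ k) ^ m := by
    rw [hZ, sum_comm]
    simp [h1]
  have e2 : ∑ φ, Z φ ^ 2 = 2 ^ n * ∑ j ∈ range (n + 1), (n.choose j : ℝ) *
          ((2 * (n:ℝ)) ^ k - 2 * n ^ k + ((n - j : ℕ) : ℝ) ^ k) ^ m := by
    have : ∀ φ, Z φ ^ 2 = ∑ a, ∑ b, (if SatFormula a φ then (1:ℝ) else 0) *
      (if SatFormula b φ then (1:ℝ) else 0) := by
      intro φ
      rw [sq, hZ, Finset.sum_mul_sum]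
    simp only [this]
    rw [sum_comm]
    have h4 : ∀ a : Assignment n, ∑ φ : Formula n k m, ∑ b, (if SatFormula a φ then (1:ℝ) else 0) *
      (if SatFormula b φ then (1:ℝ) else 0) = ∑ j ∈ range (n + 1), (n.choose j : ℝ) *
          ((2 * (n:ℝ)) ^ k - 2 * n ^ k + ((n - j : ℕ) : ℝ) ^ k) ^ m := by
      intro a
      rw [sum_comm]
      simp only [h2]
      exact sum_dist a (fun j => ((2 * (n:ℝ)) ^ k - 2 * n ^ k + ((n - j : ℕ) : ℝ) ^ k) ^ m)
    rw [sum_congr rfl fun a _ => h4 a]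
    simp
  rw [← e1, ← e2, mul_sum, mul_sum, ← sum_sub_distrib, ← Finset.sum_boole]
  apply sum_le_sum
  intro φ _
  split_ifs with h
  · nlinarith [sq_nonneg (1 - l * Z φ)]
  · have : Z φ = 0 := by
      apply sum_eq_zero
      intro a _
      rw [if_neg]
      exact fun h' => h ⟨a, h'⟩
    rw [this]; simp

/-- fraction of the sphere of radius `t` about `a` violating the clause `c`. -/
noncomputable def viol {n k : ℕ} (t : ℕ) (a : Assignment n) (c : Clause n k) : ℝ :=
  (((univ : Finset (Assignment n)).filter fun h => hammingDist a h = t ∧ ¬ SatClause h c).card : ℝ)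
    / (n.choose t : ℝ)

lemma viol_nonneg {n k : ℕ} (t : ℕ) (a : Assignment n) (c : Clause n k) : 0 ≤ viol t a c := by
  unfold viol; positivity

lemma viol_le {n k : ℕ} (t : ℕ) (htn : t ≤ n) (hn : 0 < n) (a : Assignment n) (c : Clause n k)
    (hc : SatClause a c) : viol t a c ≤ (t : ℝ) / n := by
  obtain ⟨i, hi⟩ := hc
  have hC : (0:ℝ) < n.choose t := by exact_mod_cast Nat.choose_pos htn
  have hn' : (0:ℝ) < n := by exact_mod_cast hn
  unfold viol
  rw [div_le_div_iff₀ hC hn', ← card_sphere_diff a t (c i).1, mul_comm]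
  apply mul_le_mul_of_nonneg_left _ hn'.le
  norm_cast
  apply card_le_card
  intro h
  simp only [mem_filter, mem_univ, true_and]
  rintro ⟨h1, h2⟩
  refine ⟨h1, fun h3 => h2 ⟨i, ?_⟩⟩
  rw [← h3, hi]

lemma viol_sum {n k : ℕ} (t : ℕ) (htn : t ≤ n) (a : Assignment n) :
    ∑ c ∈ (univ : Finset (Clause n k)).filter (fun c => SatClause a c), viol t a c
      = n ^ k - ((n - t : ℕ) : ℝ) ^ k := by
  have hC : (0:ℝ) < n.choose t := by exact_mod_cast Nat.choose_pos htn
  unfold viol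
  rw [← sum_div, div_eq_iff hC.ne']
  have h1 : ∀ c : Clause n k, (((univ : Finset (Assignment n)).filter
      fun h => hammingDist a h = t ∧ ¬ SatClause h c).card : ℝ)
      = ∑ h ∈ (univ : Finset (Assignment n)).filter (fun h => hammingDist a h = t),
        (if ¬ SatClause h c then (1:ℝ) else 0) := by
    intro c
    rw [Finset.sum_boole, filter_filter]
  simp only [h1]
  rw [sum_comm]
  have h2 : ∀ h ∈ (univ : Finset (Assignment n)).filter (fun h => hammingDist a h = t),
      ∑ c ∈ (univ : Finset (Clause n k)).filter (fun c => SatClause a c),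
        (if ¬ SatClause h c then (1:ℝ) else 0) = n ^ k - ((n - t : ℕ) : ℝ) ^ k := by
    intro h hh
    rw [Finset.sum_boole, filter_filter, card_sat_unsat, (mem_filter.1 hh).2]
  rw [sum_congr rfl h2, sum_const, card_sphere]
  simp [mul_comm]

lemma exp_chord {s A y : ℝ} (hA : 0 < A) (h0 : 0 ≤ y) (h1 : y ≤ A) :
    Real.exp (s * y) ≤ 1 + (Real.exp (s * A) - 1) * (y / A) := by
  have hw : 0 ≤ 1 - y / A := by rw [sub_nonneg, div_le_one hA]; exact h1
  have h := convexOn_exp.2 (Set.mem_univ (0:ℝ)) (Set.mem_univ (s * A)) hw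
    (div_nonneg h0 hA.le) (by ring)
  simp only [smul_eq_mul, mul_zero, zero_add, Real.exp_zero, mul_one] at h
  have e : y / A * (s * A) = s * y := by field_simp
  rw [e] at h
  linarith

lemma mgf_clause {n k : ℕ} (t : ℕ) (htn : t ≤ n) (hn : 0 < n) (ht0 : 0 < t) (a : Assignment n)
    (s : ℝ) :
    ∑ c ∈ (univ : Finset (Clause n k)).filter (fun c => SatClause a c), Real.exp (s * viol t a c)
      ≤ ((2 * (n:ℝ)) ^ k - n ^ k) + (Real.exp (s * (t / n)) - 1) / (t / n) *
        (n ^ k - ((n - t : ℕ) : ℝ) ^ k) := by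
  have hA : (0:ℝ) < (t:ℝ) / n := by
    have : (0:ℝ) < n := by exact_mod_cast hn
    have : (0:ℝ) < t := by exact_mod_cast ht0
    positivity
  calc _ ≤ ∑ c ∈ (univ : Finset (Clause n k)).filter (fun c => SatClause a c),
        (1 + (Real.exp (s * (t / n)) - 1) / (t / n) * viol t a c) := by
        apply sum_le_sum
        intro c hc
        have := exp_chord (s := s) hA (viol_nonneg t a c) (viol_le t htn hn a c (mem_filter.1 hc).2)
        refine this.trans (le_of_eq ?_)
        ring
    _ = _ := by
        rw [sum_add_distrib, ← mul_sum, viol_sum t htn, ← card_sat a]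
        simp

lemma tail_count {n k m : ℕ} (t : ℕ) (htn : t ≤ n) (hn : 0 < n) (ht0 : 0 < t) (a : Assignment n)
    (s θ : ℝ) (hs : 0 ≤ s) :
    (((univ : Finset (Formula n k m)).filter fun φ => SatFormula a φ ∧
        θ * m < ∑ j, viol t a (φ j)).card : ℝ)
    ≤ (Real.exp (-(s * θ)) * (((2 * (n:ℝ)) ^ k - n ^ k) + (Real.exp (s * (t / n)) - 1) / (t / n) *
        (n ^ k - ((n - t : ℕ) : ℝ) ^ k))) ^ m := by
  have h1 : ∑ φ ∈ Fintype.piFinset (fun _ : Fin m =>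
        (univ : Finset (Clause n k)).filter (fun c => SatClause a c)),
        ∏ j, Real.exp (s * viol t a (φ j))
      = (∑ c ∈ (univ : Finset (Clause n k)).filter (fun c => SatClause a c),
          Real.exp (s * viol t a c)) ^ m := by
    rw [← Finset.prod_univ_sum (fun _ : Fin m =>
        (univ : Finset (Clause n k)).filter (fun c => SatClause a c))
        (fun _ c => Real.exp (s * viol t a c))]
    simp
  have h2 : (((univ : Finset (Formula n k m)).filter fun φ => SatFormula a φ ∧
        θ * m < ∑ j, viol t a (φ j)).card : ℝ)
      ≤ ∑ φ ∈ Fintype.piFinset (fun _ : Fin m =>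
        (univ : Finset (Clause n k)).filter (fun c => SatClause a c)),
        Real.exp (-(s * θ)) ^ m * ∏ j, Real.exp (s * viol t a (φ j)) := by
    rw [Finset.card_eq_sum_ones, Nat.cast_sum]
    refine le_trans (sum_le_sum (g := fun φ : Formula n k m =>
      Real.exp (-(s * θ)) ^ m * ∏ j, Real.exp (s * viol t a (φ j))) ?_) ?_
    · intro φ hφ
      have h := (mem_filter.1 hφ).2.2
      rw [← Real.exp_sum, ← mul_sum, ← Real.exp_nat_mul, ← Real.exp_add]
      push_cast
      apply Real.one_le_exp
      have := mul_le_mul_of_nonneg_left h.le hs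
      linarith
    · apply sum_le_sum_of_subset_of_nonneg
      · intro φ hφ
        have h := (mem_filter.1 hφ).2.1
        simp only [Fintype.mem_piFinset, mem_filter, mem_univ, true_and]
        exact h
      · intro φ _ _
        positivity
  refine h2.trans ?_
  rw [← mul_sum, h1, ← mul_pow]
  apply pow_le_pow_left₀
  · apply mul_nonneg (Real.exp_pos _).le
    exact sum_nonneg fun c _ => (Real.exp_pos _).le
  · exact mul_le_mul_of_nonneg_left (mgf_clause t htn hn ht0 a s) (Real.exp_pos _).le

lemma good_count {n k m : ℕ} (t : ℕ) (htn : t ≤ n) (hn : 0 < n) (a : Assignment n)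
    (φ : Formula n k m) (ε : ℝ) (hε : 0 < ε)
    (h : ∑ j, viol t a (φ j) ≤ (1 - 1 / n) * ε * m) :
    (n.choose t : ℝ) / n ≤ ((univ : Finset (Assignment n)).filter fun h =>
      hammingDist h a ≤ t ∧ (1 - ε) * m ≤ (numSat φ h : ℝ)).card := by
  have hC : (0:ℝ) < n.choose t := by exact_mod_cast Nat.choose_pos htn
  have hn' : (0:ℝ) < n := by exact_mod_cast hn
  have hn1 : (1:ℝ) ≤ n := by exact_mod_cast hn
  set K := (univ : Finset (Assignment n)).filter fun h => hammingDist a h = t with hK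
  have hsplit := Finset.card_filter_add_card_filter_not (s := K)
    (fun h => (1 - ε) * m ≤ (numSat φ h : ℝ))
  rw [hK, card_sphere, ← hK] at hsplit
  have hsplit' : ((_ + _ : ℕ) : ℝ) = ((_ : ℕ) : ℝ) := congrArg _ hsplit
  push_cast at hsplit'
  have hsub : ((K.filter fun h => (1 - ε) * m ≤ (numSat φ h : ℝ)).card : ℝ) ≤
      ((univ : Finset (Assignment n)).filter fun h =>
      hammingDist h a ≤ t ∧ (1 - ε) * m ≤ (numSat φ h : ℝ)).card := by
    norm_cast
    apply card_le_card
    intro h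
    simp only [hK, mem_filter, mem_univ, true_and]
    rintro ⟨h1, h2⟩
    exact ⟨by rw [hammingDist_comm, h1], h2⟩
  refine le_trans ?_ hsub
  have hns : ∀ h, (numSat φ h : ℝ) + (numUnsat φ h : ℝ) = m := by
    intro h
    have := Finset.card_filter_add_card_filter_not (s := (univ : Finset (Fin m)))
      (fun j => SatClause h (φ j))
    rw [card_univ, Fintype.card_fin] at this
    unfold numSat numUnsat
    exact_mod_cast this
  have hmain : ((K.filter fun h => ¬ (1 - ε) * m ≤ (numSat φ h : ℝ)).card : ℝ)
      ≤ (1 - 1 / n) * n.choose t := by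
    rcases Nat.eq_zero_or_pos m with hm | hm
    · have : (K.filter fun h => ¬ (1 - ε) * m ≤ (numSat φ h : ℝ)) = ∅ := by
        apply filter_eq_empty_iff.2
        intro h _
        simp [hm]
      rw [this]
      have : 1 / (n:ℝ) ≤ 1 := by rw [div_le_one hn']; exact hn1
      simp only [card_empty, Nat.cast_zero]
      exact mul_nonneg (by linarith) hC.le
    · have hm' : (0:ℝ) < m := by exact_mod_cast hm
      have hem : 0 < ε * m := by positivity
      have hsw : ∑ h ∈ K, (numUnsat φ h : ℝ) = (∑ j, viol t a (φ j)) * n.choose t := by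
        have e1 : ∀ h, (numUnsat φ h : ℝ) = ∑ j, if ¬ SatClause h (φ j) then (1:ℝ) else 0 := by
          intro h
          rw [Finset.sum_boole]; rfl
        simp only [e1]
        rw [sum_comm, sum_mul]
        refine sum_congr rfl fun j _ => ?_
        rw [Finset.sum_boole, hK, filter_filter, viol, div_mul_cancel₀ _ hC.ne']
      have h1 : ((K.filter fun h => ¬ (1 - ε) * m ≤ (numSat φ h : ℝ)).card : ℝ) * (ε * m)
          ≤ ∑ h ∈ K, (numUnsat φ h : ℝ) := by
        rw [← nsmul_eq_mul]
        refine le_trans (Finset.card_nsmul_le_sum _ (fun h => (numUnsat φ h : ℝ)) _ ?_)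
          (sum_le_sum_of_subset_of_nonneg (filter_subset _ _) fun _ _ _ => by positivity)
        intro h hh
        have h2 := (mem_filter.1 hh).2
        have h3 := hns h
        push Not at h2
        show ε * m ≤ (numUnsat φ h : ℝ)
        nlinarith
      rw [hsw] at h1
      have h2 := mul_le_mul_of_nonneg_right h hC.le
      have h3 := h1.trans h2
      have h4 : (1 - 1 / (n:ℝ)) * ε * m * n.choose t = (1 - 1 / n) * n.choose t * (ε * m) := by ring
      rw [h4] at h3
      exact le_of_mul_le_mul_right h3 hem
  have : (n.choose t : ℝ) / n = n.choose t - (1 - 1 / n) * n.choose t := by ring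
  linarith

lemma miss_count {n : ℕ} (t N : ℕ) (htn : t ≤ n) (hn : 0 < n) 
    (hN : (2 * (n : ℝ) ^ 2 * 2 ^ n) / (n.choose t : ℝ) ≤ N) (G : Assignment n → Prop)
    (hG : (n.choose t : ℝ) / n ≤ ((univ : Finset (Assignment n)).filter fun h => G h).card) :
    (((univ : Finset (Fin N → Assignment n)).filter fun s => ∀ i, ¬ G (s i)).card : ℝ)
      ≤ ((2:ℝ) ^ n) ^ N * Real.exp (-(2 * n)) := by
  have hC : (0:ℝ) < n.choose t := by exact_mod_cast Nat.choose_pos htn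
  have hn' : (0:ℝ) < n := by exact_mod_cast hn
  have h1 : ((univ : Finset (Fin N → Assignment n)).filter fun s => ∀ i, ¬ G (s i))
      = Fintype.piFinset (fun _ => (univ : Finset (Assignment n)).filter fun h => ¬ G h) := by
    ext c
    simp [Fintype.mem_piFinset]
  rw [h1, Fintype.card_piFinset_const]
  have h2 := Finset.card_filter_add_card_filter_not (s := (univ : Finset (Assignment n)))
      (fun h => G h)
  have h3 : ((_ + _ : ℕ) : ℝ) = ((_ : ℕ) : ℝ) := congrArg _ h2
  push_cast at h3
  have h4 : (Fintype.card (Assignment n) : ℝ) = 2 ^ n := by simp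
  rw [card_univ, h4] at h3
  set g : ℝ := (((univ : Finset (Assignment n)).filter fun h => G h).card : ℝ) with hg
  have hb : (((univ : Finset (Assignment n)).filter fun h => ¬ G h).card : ℝ)
      ≤ 2 ^ n * Real.exp (-(g / 2 ^ n)) := by
    have : 1 - g / 2 ^ n ≤ Real.exp (-(g / 2 ^ n)) := Real.one_sub_le_exp_neg _
    have h5 := mul_le_mul_of_nonneg_left this (by positivity : (0:ℝ) ≤ 2 ^ n)
    have h6 : (2:ℝ) ^ n * (1 - g / 2 ^ n) = 2 ^ n - g := by field_simp
    linarith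
  push_cast
  refine (pow_le_pow_left₀ (by positivity) hb N).trans ?_
  rw [mul_pow]
  apply mul_le_mul_of_nonneg_left _ (by positivity)
  rw [← Real.exp_nat_mul]
  apply Real.exp_le_exp.2
  have h7 : 2 * (n:ℝ) ≤ N * (g / 2 ^ n) := by
    calc 2 * (n:ℝ) = (2 * (n : ℝ) ^ 2 * 2 ^ n) / (n.choose t : ℝ) * ((n.choose t : ℝ) / n / 2 ^ n) := by
          field_simp
      _ ≤ _ := by gcongr
  linarith

lemma bad_count {n k m : ℕ} (t N : ℕ) (htn : t ≤ n) (hn : 0 < n) (ht0 : 0 < t)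
    (hN : (2 * (n : ℝ) ^ 2 * 2 ^ n) / (n.choose t : ℝ) ≤ N)
    (ε s : ℝ) (hε : 0 < ε) (hs : 0 ≤ s) :
    (((univ : Finset (Formula n k m)).filter fun φ =>
              ∃ a : Assignment n, SatFormula a φ).card : ℝ) * ((2:ℝ) ^ n) ^ N
      - (((((univ : Finset (Formula n k m)).filter fun φ =>
              ∃ a : Assignment n, SatFormula a φ) ×ˢ
              (univ : Finset (Fin N → Assignment n))).filter fun p =>
            ∃ i : Fin N, ∃ a : Assignment n, SatFormula a p.1 ∧
              hammingDist (p.2 i) a ≤ t ∧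
              (1 - ε) * m ≤ (numSat p.1 (p.2 i) : ℝ)).card : ℝ)
    ≤ ((2:ℝ) ^ n) ^ N * (2 ^ n * ((2 * (n:ℝ)) ^ k - n ^ k) ^ m * Real.exp (-(2 * n))
      + 2 ^ n * (Real.exp (-(s * ((1 - 1 / n) * ε))) *
          (((2 * (n:ℝ)) ^ k - n ^ k) + (Real.exp (s * (t / n)) - 1) / (t / n) *
        (n ^ k - ((n - t : ℕ) : ℝ) ^ k))) ^ m) := by
  set θ := (1 - 1 / (n:ℝ)) * ε with hθ
  set W : ℝ := ((2:ℝ) ^ n) ^ N with hW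
  have hW0 : 0 ≤ W := by positivity
  have hcard : (Fintype.card (Fin N → Assignment n) : ℝ) = W := by simp [hW]
  have hsplit := Finset.card_filter_add_card_filter_not
    (s := ((univ : Finset (Formula n k m)).filter fun φ =>
              ∃ a : Assignment n, SatFormula a φ) ×ˢ
              (univ : Finset (Fin N → Assignment n)))
    (fun p => ∃ i : Fin N, ∃ a : Assignment n, SatFormula a p.1 ∧
              hammingDist (p.2 i) a ≤ t ∧
              (1 - ε) * m ≤ (numSat p.1 (p.2 i) : ℝ))
  rw [card_product] at hsplit
  have h3 : ((_ + _ : ℕ) : ℝ) = ((_ : ℕ) : ℝ) := congrArg _ hsplit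
  push_cast [card_univ] at h3
  rw [hcard] at h3
  rw [← h3, add_sub_cancel_left]
  set Bd : Assignment n → Finset (Formula n k m × (Fin N → Assignment n)) := fun a =>
    univ.filter fun p => SatFormula a p.1 ∧ ∀ i, ¬ (hammingDist (p.2 i) a ≤ t ∧
              (1 - ε) * m ≤ (numSat p.1 (p.2 i) : ℝ)) with hBd
  have hle : ∀ S : Finset (Formula n k m × (Fin N → Assignment n)),
      S ⊆ univ.biUnion Bd → (S.card : ℝ) ≤ ∑ a, ((Bd a).card : ℝ) := by
    intro S hS
    have := (card_le_card hS).trans card_biUnion_le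
    exact_mod_cast this
  refine (hle _ ?_).trans ?_
  · intro p hp
    simp only [mem_filter, mem_product, mem_univ, true_and, and_true] at hp
    obtain ⟨⟨a, ha⟩, h⟩ := hp
    simp only [mem_biUnion, hBd, mem_filter, mem_univ, true_and]
    exact ⟨a, ha, fun i hi => h ⟨i, a, ha, hi⟩⟩
  · have hB : ∀ a, ((Bd a).card : ℝ) ≤ W * (((2 * (n:ℝ)) ^ k - n ^ k) ^ m * Real.exp (-(2 * n))
      + (Real.exp (-(s * θ)) *
          (((2 * (n:ℝ)) ^ k - n ^ k) + (Real.exp (s * (t / n)) - 1) / (t / n) *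
        (n ^ k - ((n - t : ℕ) : ℝ) ^ k))) ^ m) := by
      intro a
      have e1 : ((Bd a).card : ℝ) = ∑ φ : Formula n k m, if SatFormula a φ then
          (((univ : Finset (Fin N → Assignment n)).filter fun s => ∀ i,
            ¬ (hammingDist (s i) a ≤ t ∧ (1 - ε) * m ≤ (numSat φ (s i) : ℝ))).card : ℝ) else 0 := by
        rw [hBd, ← Finset.sum_boole, Fintype.sum_prod_type]
        refine sum_congr rfl fun φ _ => ?_
        by_cases h : SatFormula a φ
        · simp only [h, true_and, if_true]
          rw [Finset.sum_boole]
        · simp only [h, false_and, if_false, sum_const_zero]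
      have e2 : ∀ φ : Formula n k m, (if SatFormula a φ then
          (((univ : Finset (Fin N → Assignment n)).filter fun s => ∀ i,
            ¬ (hammingDist (s i) a ≤ t ∧ (1 - ε) * m ≤ (numSat φ (s i) : ℝ))).card : ℝ) else 0)
          ≤ W * Real.exp (-(2 * n)) * (if SatFormula a φ then 1 else 0) +
            W * (if SatFormula a φ ∧ θ * m < ∑ j, viol t a (φ j) then 1 else 0) := by
        intro φ
        have hE := Real.exp_pos (-(2 * (n:ℝ)))
        by_cases h : SatFormula a φ
        · by_cases h' : θ * m < ∑ j, viol t a (φ j)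
          · simp only [h, h', if_true, and_self, mul_one]
            have : (((univ : Finset (Fin N → Assignment n)).filter fun s => ∀ i,
              ¬ (hammingDist (s i) a ≤ t ∧ (1 - ε) * m ≤ (numSat φ (s i) : ℝ))).card : ℝ) ≤ W := by
              rw [← hcard]
              exact_mod_cast card_le_univ _
            have : 0 ≤ W * Real.exp (-(2 * n)) := by positivity
            linarith
          · simp only [h, h', if_true, and_false, if_false, mul_one, mul_zero, add_zero]
            push Not at h'
            have g := good_count t htn hn a φ ε hε h'
            have := miss_count t N htn hn hN (fun h => hammingDist h a ≤ t ∧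
              (1 - ε) * m ≤ (numSat φ h : ℝ)) (by convert g)
            convert this
        · simp [h]
      rw [e1]
      refine (sum_le_sum fun φ _ => e2 φ).trans ?_
      rw [sum_add_distrib, ← mul_sum, ← mul_sum, Finset.sum_boole, Finset.sum_boole]
      have c1 := card_forall (m := m) (fun c : Clause n k => SatClause a c)
        (fun φ => SatFormula a φ) (fun φ => Iff.rfl)
      have c1' : (((univ : Finset (Formula n k m)).filter fun φ => SatFormula a φ).card : ℝ)
        = ((2 * (n:ℝ)) ^ k - n ^ k) ^ m := by
        rw [← card_sat a]; exact_mod_cast c1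
      have c2 := tail_count (m := m) (k := k) t htn hn ht0 a s θ hs
      have c3 := mul_le_mul_of_nonneg_left c2 hW0
      rw [c1']
      refine le_trans (add_le_add_right ((le_of_eq ?_).trans c3) _) (le_of_eq (by ring))
      congr!
    refine (sum_le_sum fun a _ => hB a).trans (le_of_eq ?_)
    rw [sum_const, card_univ, nsmul_eq_mul]
    have : (Fintype.card (Assignment n) : ℝ) = 2 ^ n := by simp
    rw [this]; ring

lemma alpha_le (k : ℕ) (hk : 60 ≤ k) (α : ℝ) (h : α ≤ 1 / Real.sqrt k) : α ≤ 13 / 100 := by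
  have h1 : (77/10 : ℝ) ≤ Real.sqrt k := by
    apply Real.le_sqrt_of_sq_le
    have : (60:ℝ) ≤ k := by exact_mod_cast hk
    norm_num; linarith
  refine h.trans ?_
  rw [div_le_iff₀ (by linarith)]
  linarith

lemma one_sub_delta (k : ℕ) (hk : 60 ≤ k) (α : ℝ) (h0 : 0 < α) (h : α ≤ 13 / 100) :
    7 * α ≤ 1 - (1 - α) ^ k := by
  have h1 : (1 - α) ^ k ≤ (1 - α) ^ 60 := pow_le_pow_of_le_one (by linarith) (by linarith) hk
  have h2 := mul_neg_geom_sum (1 - α) 60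
  have h3 : ∑ i ∈ range 60, (87/100:ℝ) ^ i ≤ ∑ i ∈ range 60, (1 - α) ^ i := by
    apply sum_le_sum
    intro i _
    exact pow_le_pow_left₀ (by norm_num) (by linarith) i
  have h4 : (7:ℝ) ≤ ∑ i ∈ range 60, (87/100:ℝ) ^ i := by
    rw [geom_sum_eq (by norm_num)]
    norm_num
  have h5 := mul_le_mul_of_nonneg_left (h4.trans h3) h0.le
  have h6 : 1 - (1 - α) = α := by ring
  rw [h6] at h2
  linarith

lemma delta_q (k : ℕ) (hk : 60 ≤ k) (α : ℝ) (h : α ≤ 13 / 100) :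
    10 * Real.sqrt ((1/2:ℝ)^k) ≤ ((1 - α) ^ k) ^ 2 := by
  have h0 : Real.sqrt (((1/2:ℝ)^k)) ≤ ((1 - α) ^ k) ^ 2 / 10 := by
    apply Real.sqrt_le_iff.2
    refine ⟨by positivity, ?_⟩
    have e : (((1 - α) ^ k) ^ 2 / 10) ^ 2 = (2 * (1 - α) ^ 4) ^ k * (1/2)^k / 100 := by
      rw [← mul_pow, ← pow_mul, div_pow, ← pow_mul, mul_assoc 2, mul_comm 2, mul_assoc]
      norm_num
      have e' : (1 - α) ^ 4 * (1 / 2) * 2 = (1 - α) ^ 4 := by ring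
      rw [e', ← pow_mul, mul_comm]
    rw [e]
    have h2 : (114/100:ℝ) ≤ 2 * (1 - α) ^ 4 := by
      have : (87/100:ℝ)^4 ≤ (1 - α) ^ 4 := pow_le_pow_left₀ (by norm_num) (by linarith) 4
      norm_num at this ⊢
      linarith
    have h3 : (100:ℝ) ≤ (2 * (1 - α) ^ 4) ^ k := by
      calc (100:ℝ) ≤ (114/100) ^ 60 := by norm_num
        _ ≤ (114/100) ^ k := pow_le_pow_right₀ (by norm_num) hk
        _ ≤ _ := pow_le_pow_left₀ (by norm_num) h2 k
    have := mul_le_mul_of_nonneg_right h3 (by positivity : (0:ℝ) ≤ (1/2)^k)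
    linarith
  linarith

lemma exp_quad {u : ℝ} (h0 : 0 ≤ u) (h1 : u ≤ 1) : Real.exp u - 1 ≤ u + u ^ 2 := by
  have h := Real.abs_exp_sub_one_sub_id_le (x := u) (by rw [abs_of_nonneg h0]; exact h1)
  linarith [(abs_le.mp h).2]

/-- the per-clause tilted factor. -/
lemma rho_le (n : ℕ) (K Q α δ : ℝ) (hK : 2 ≤ K) (hQ : Q = 1 / K) (hα : 0 < α)
    (hδ0 : 0 < δ) (hδ1 : δ < 1) (hn : 40 ≤ n * δ) (hn0 : 0 < n) :
    Real.exp (-(δ / (2 * α) * ((1 - 1 / n) * ((1 - δ ^ 2) / (K - 1))))) *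
      ((1 - Q) + (Real.exp (δ / (2 * α) * α) - 1) / α * (Q * (1 - δ)))
    ≤ (1 - Q) * Real.exp (-(δ ^ 2 * ((1 - δ) / ((K - 1) * α)) / 5)) := by
  have hn' : (0:ℝ) < n := by exact_mod_cast hn0
  have hK0 : 0 < K - 1 := by linarith
  set w := (1 - δ) / ((K - 1) * α) with hw
  have hw0 : 0 ≤ w := div_nonneg (by linarith) (by positivity)
  have e1 : (1 - Q) + (Real.exp (δ / (2 * α) * α) - 1) / α * (Q * (1 - δ))
      = (1 - Q) * (1 + (Real.exp (δ / 2) - 1) * w) := by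
    have : δ / (2 * α) * α = δ / 2 := by field_simp
    rw [this, hw, hQ]
    field_simp
  have hQ1 : 0 ≤ 1 - Q := by
    rw [hQ, sub_nonneg, div_le_one (by linarith)]; linarith
  rw [e1]
  have h2 : 1 + (Real.exp (δ / 2) - 1) * w ≤ Real.exp ((δ / 2 + (δ / 2) ^ 2) * w) := by
    have a := mul_le_mul_of_nonneg_right (exp_quad (u := δ / 2) (by linarith) (by linarith)) hw0
    have b := Real.add_one_le_exp ((δ / 2 + (δ / 2) ^ 2) * w)
    linarith
  have e2 : δ / (2 * α) * ((1 - 1 / n) * ((1 - δ ^ 2) / (K - 1)))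
      = δ / 2 * (1 - 1 / n) * (1 + δ) * w := by
    rw [hw]; field_simp; ring
  rw [e2]
  calc _ ≤ Real.exp (-(δ / 2 * (1 - 1 / n) * (1 + δ) * w)) *
        ((1 - Q) * Real.exp ((δ / 2 + (δ / 2) ^ 2) * w)) := by gcongr
    _ = (1 - Q) * Real.exp (w * (δ / 2) * (δ / 2 - δ + (1 + δ) * (1 / n))) := by
        rw [mul_left_comm, ← Real.exp_add]
        congr 2; ring
    _ ≤ _ := by
        apply mul_le_mul_of_nonneg_left _ hQ1
        apply Real.exp_le_exp.2
        have h3 : (1:ℝ) / n ≤ δ / 40 := by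
          rw [div_le_iff₀ hn']; linarith
        have h4 : (1 + δ) * (1 / n) ≤ 2 * (δ / 40) :=
          mul_le_mul (by linarith) h3 (by positivity) (by norm_num)
        have h5 : δ / 2 - δ + (1 + δ) * (1 / n) ≤ - (2 * δ / 5) := by linarith
        have := mul_le_mul_of_nonneg_left h5 (by positivity : 0 ≤ w * (δ / 2))
        linarith

set_option maxHeartbeats 4000000 in
/-- Summing the per-`m` estimates against the Poisson weights. -/
lemma poisson_combine (n k : ℕ) (hn : 0 < n) (hk : 60 ≤ k)
    (d : ℝ) (hd1 : 2 ^ k * Real.log 2 - (1 + Real.log 2) ≤ d) (hd2 : d ≤ 2 ^ k * Real.log 2)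
    (Q ρ δ τ : ℝ) (hQ : Q = (1/2)^k) (pois P G : ℕ → ℝ)
    (hpois : pois = fun m => Real.exp (-(d * n)) * (d * n) ^ m / (Nat.factorial m))
    (hP0 : ∀ m, 0 ≤ P m) (hP1 : ∀ m, P m ≤ 1) (hG0 : ∀ m, 0 ≤ G m) (hG1 : ∀ m, G m ≤ 1)
    (hPl : ∀ (l : ℝ) m, 2 * l * (2 ^ n * (1 - Q) ^ m)
      - l ^ 2 * (2 ^ n * ∑ j ∈ range (n + 1), (n.choose j : ℝ) *
          (1 - 2 * Q + Q * (1 - (j:ℝ) / n) ^ k) ^ m) ≤ P m)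
    (hPG : ∀ m, P m - G m ≤ 2 ^ n * (1 - Q) ^ m * Real.exp (-(2 * n)) + 2 ^ n * ρ ^ m)
    (hρ : ρ ≤ (1 - Q) * Real.exp (-(δ ^ 2 * τ * Q / (1 - Q) / 5)))
    (hτ : 7 ≤ τ) (hτk : τ ≤ k) (hδ0 : 0 < δ) (hδ1 : δ < 1)
    (hδq : 10 * Real.sqrt ((1/2:ℝ)^k) ≤ δ ^ 2) (hnδ : 46 ≤ n * δ ^ 2) :
    (1 - 3 * Real.exp (-δ ^ 2 * Real.log 2 * n / 32)) * ∑' m, pois m * P m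
      ≤ ∑' m, pois m * G m := by
  set L := Real.log 2 with hL
  have hLlo : (0.69:ℝ) < L := by have := Real.log_two_gt_d9; rw [← hL] at this; linarith
  have hLhi : L < 0.6932 := by have := Real.log_two_lt_d9; rw [← hL] at this; linarith
  have hn' : (0:ℝ) < n := by exact_mod_cast hn
  have hK : (2:ℝ) ^ k * Q = 1 := by rw [hQ, ← mul_pow]; norm_num
  have hQ0 : 0 < Q := by rw [hQ]; positivity
  have hkQ : (k:ℝ) * Q ≤ 1 := by
    have : (k:ℝ) ≤ 2 ^ k := by exact_mod_cast (Nat.lt_two_pow_self (n := k)).le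
    have := mul_le_mul_of_nonneg_right this hQ0.le
    linarith
  have hQs : Q ≤ 1 / 1000 := by
    rw [hQ]
    calc ((1:ℝ)/2)^k ≤ (1/2)^60 := pow_le_pow_of_le_one (by norm_num) (by norm_num) hk
      _ ≤ 1 / 1000 := by norm_num
  set q := Real.sqrt ((1/2:ℝ)^k) with hq
  have hq0 : 0 ≤ q := Real.sqrt_nonneg _
  have hq2 : q ^ 2 = Q := by rw [hq, sq_q, hQ]
  have hQq : Q ≤ q := by
    rw [← hq2]
    have : q ≤ 1 := by
      rw [hq, Real.sqrt_le_iff]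
      exact ⟨by norm_num, by
        rw [one_pow]; exact pow_le_one₀ (by norm_num) (by norm_num)⟩
    nlinarith
  have hdQ1 : L - 2 * Q ≤ d * Q := by
    have := mul_le_mul_of_nonneg_right hd1 hQ0.le
    have e : (2 ^ k * L - (1 + L)) * Q = (2 ^ k * Q) * L - (1 + L) * Q := by ring
    rw [e, hK] at this
    nlinarith
  have hdQ2 : d * Q ≤ L := by
    have := mul_le_mul_of_nonneg_right hd2 hQ0.le
    have e : 2 ^ k * L * Q = (2 ^ k * Q) * L := by ring
    rw [e, hK] at this
    linarith
  have hd0 : 0 < d := by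
    have : 0 < d * Q := by linarith
    exact pos_of_mul_pos_left this hQ0.le
  set c := d * n with hc
  have hc0 : 0 < c := by positivity
  have hpos : ∀ m, 0 ≤ pois m := by intro m; rw [hpois]; positivity
  have hS : ∀ x : ℝ, HasSum (fun m => pois m * x ^ m) (Real.exp (-(c * (1 - x)))) := by
    intro x; rw [hpois]; exact pois_hasSum c x
  have hs1 : Summable pois := by
    have := (hS 1).summable; simpa using this
  have sP : Summable fun m => pois m * P m :=
    Summable.of_nonneg_of_le (fun m => mul_nonneg (hpos m) (hP0 m))
      (fun m => mul_le_of_le_one_right (hpos m) (hP1 m)) hs1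
  have sG : Summable fun m => pois m * G m :=
    Summable.of_nonneg_of_le (fun m => mul_nonneg (hpos m) (hG0 m))
      (fun m => mul_le_of_le_one_right (hpos m) (hG1 m)) hs1
  set SP := ∑' m, pois m * P m with hSP
  set SG := ∑' m, pois m * G m with hSG
  set Z := (2:ℝ) ^ n * Real.exp (-(c * Q)) with hZ
  have hZ0 : 0 < Z := by positivity
  have e2n : (2:ℝ) ^ n = Real.exp (L * n) := by
    rw [mul_comm, Real.exp_nat_mul, Real.exp_log (by norm_num)]
  -- bad event
  have hbad : SP - SG ≤ Z * Real.exp (-(2 * n)) + 2 ^ n * Real.exp (-(c * (1 - ρ))) := by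
    have h1 := sP.hasSum.sub sG.hasSum
    have h2 := ((hS (1 - Q)).mul_left (2 ^ n * Real.exp (-(2 * n)))).add
      ((hS ρ).mul_left (2 ^ n))
    have h3 := hasSum_le (fun m => ?_) h1 h2
    · refine h3.trans (le_of_eq ?_)
      rw [hZ]
      have : 1 - (1 - Q) = Q := by ring
      rw [this]; ring
    · have := mul_le_mul_of_nonneg_left (hPG m) (hpos m)
      linarith
  -- second moment
  have hsec : ∀ l : ℝ, 2 * l * Z - l ^ 2 * (2 ^ n * ∑ j ∈ range (n + 1), (n.choose j : ℝ) *
          Real.exp (-(c * (1 - (1 - 2 * Q + Q * (1 - (j:ℝ) / n) ^ k))))) ≤ SP := by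
    intro l
    have h2 := hasSum_sum (s := range (n + 1)) fun j _ =>
      (hS (1 - 2 * Q + Q * (1 - (j:ℝ) / n) ^ k)).mul_left (n.choose j : ℝ)
    have h3 := ((hS (1 - Q)).mul_left (2 * l * 2 ^ n)).sub (h2.mul_left (l ^ 2 * 2 ^ n))
    have h4 := hasSum_le (fun m => ?_) h3 sP.hasSum
    · refine le_trans (le_of_eq ?_) h4
      rw [hZ]
      have : 1 - (1 - Q) = Q := by ring
      rw [this]; ring
    · have := mul_le_mul_of_nonneg_left (hPl l m) (hpos m)
      refine le_trans (le_of_eq ?_) this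
      rw [mul_sub]
      congr 1
      · ring
      · rw [mul_sum, mul_sum, mul_sum, mul_sum]
        refine sum_congr rfl fun j _ => ?_
        ring
  have hZ2 : (2:ℝ) ^ n * ∑ j ∈ range (n + 1), (n.choose j : ℝ) *
          Real.exp (-(c * (1 - (1 - 2 * Q + Q * (1 - (j:ℝ) / n) ^ k))))
      ≤ Z ^ 2 * (4 * Real.exp (n * q)) := by
    refine le_trans ?_ (mul_le_mul_of_nonneg_left (second_sum n k hn hk) (by positivity))
    rw [mul_sum, mul_sum]
    apply sum_le_sum
    intro j hj
    have hjn : j ≤ n := by simpa [Nat.lt_succ_iff] using hj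
    have hg : 0 ≤ (1 - (j:ℝ) / n) ^ k := by
      apply pow_nonneg
      rw [sub_nonneg, div_le_one hn']; exact_mod_cast hjn
    rw [mul_left_comm, mul_left_comm (Z ^ 2)]
    apply mul_le_mul_of_nonneg_left _ (by positivity)
    rw [hZ, e2n, ← Real.exp_add, ← Real.exp_add, ← Real.exp_nat_mul, ← Real.exp_add]
    apply Real.exp_le_exp.2
    have h5 : d * Q * n * (1 - (j:ℝ) / n) ^ k ≤ L * n * (1 - (j:ℝ) / n) ^ k := by gcongr
    rw [hc]
    push_cast
    rw [← hL]
    linarith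
  have hSPlo : Real.exp (-(n * q)) / 4 ≤ SP := by
    have hE := Real.exp_pos (n * q)
    have h6 := hsec (1 / (Z * (4 * Real.exp (n * q))))
    have h7 := mul_le_mul_of_nonneg_left hZ2 (sq_nonneg (1 / (Z * (4 * Real.exp (n * q)))))
    have h8 : (1 / (Z * (4 * Real.exp (n * q)))) ^ 2 * (Z ^ 2 * (4 * Real.exp (n * q)))
        = 1 / (4 * Real.exp (n * q)) := by field_simp
    have h9 : 2 * (1 / (Z * (4 * Real.exp (n * q)))) * Z = 2 * (1 / (4 * Real.exp (n * q))) := by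
      field_simp
    rw [h8] at h7
    rw [h9] at h6
    have h10 : Real.exp (-(n * q)) / 4 = 1 / (4 * Real.exp (n * q)) := by
      rw [Real.exp_neg]; field_simp
    rw [h10]
    linarith
  have hX := mul_pos hn' (pow_pos hδ0 2)
  -- bounds on the bad event
  have hZup : Z ≤ Real.exp (2 * n * q) := by
    rw [hZ, e2n, ← Real.exp_add]
    apply Real.exp_le_exp.2
    have : L - d * Q ≤ 2 * q := by linarith
    have := mul_le_mul_of_nonneg_left this hn'.le
    rw [hc]; linarith
  have hρ2 : (2:ℝ) ^ n * Real.exp (-(c * (1 - ρ))) ≤ Z * Real.exp (-(2/5 * (n * δ ^ 2))) := by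
    rw [hZ, mul_assoc (2 ^ n)]
    apply mul_le_mul_of_nonneg_left _ (by positivity)
    rw [← Real.exp_add]
    apply Real.exp_le_exp.2
    set y := δ ^ 2 * τ * Q / (1 - Q) / 5 with hy
    have hy0 : 0 ≤ y := by
      have : 0 ≤ 1 - Q := by linarith
      have : 0 ≤ τ := by linarith
      positivity
    have hyQ : (1 - Q) * y = δ ^ 2 * τ * Q / 5 := by
      rw [hy]
      have : 1 - Q ≠ 0 := by linarith
      field_simp
    have hδ2 : δ ^ 2 ≤ 1 := pow_le_one₀ hδ0.le hδ1.le
    have hτQ : τ * Q ≤ 1 := (mul_le_mul_of_nonneg_right hτk hQ0.le).trans hkQ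
    have hτQ0 : 0 ≤ τ * Q := mul_nonneg (by linarith) hQ0.le
    have hy1 : y ≤ 1 := by
      have : δ ^ 2 * (τ * Q) ≤ 1 := mul_le_one₀ hδ2 hτQ0 hτQ
      nlinarith
    have h1 := exp_neg_half hy0 hy1
    have h2 := mul_le_mul_of_nonneg_left h1 (by linarith : 0 ≤ 1 - Q)
    have h3 : ρ ≤ (1 - Q) - δ ^ 2 * τ * Q / 10 := by
      have : (1 - Q) * (1 - y / 2) = (1 - Q) - ((1 - Q) * y) / 2 := by ring
      rw [this, hyQ] at h2
      linarith
    have h4 : c * (Q + δ ^ 2 * τ * Q / 10) ≤ c * (1 - ρ) :=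
      mul_le_mul_of_nonneg_left (by linarith) hc0.le
    have h5 : c * (δ ^ 2 * τ * Q / 10) = (d * Q) * τ / 10 * (n * δ ^ 2) := by rw [hc]; ring
    have h6 : 2 / 5 ≤ (d * Q) * τ / 10 := by
      have : (0.68:ℝ) ≤ d * Q := by linarith
      nlinarith
    have h7 := mul_le_mul_of_nonneg_right h6 hX.le
    linarith
  have hbad2 : SP - SG ≤ 2 * Real.exp (2 * n * q) * Real.exp (-(2/5 * (n * δ ^ 2))) := by
    have h1 : Real.exp (-(2 * n)) ≤ Real.exp (-(2/5 * (n * δ ^ 2))) := by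
      apply Real.exp_le_exp.2
      have hδ2 : δ ^ 2 ≤ 1 := pow_le_one₀ hδ0.le hδ1.le
      nlinarith
    have h2 := mul_le_mul_of_nonneg_left h1 hZ0.le
    have h3 := mul_le_mul_of_nonneg_right hZup (Real.exp_pos (-(2/5 * (n * δ ^ 2)))).le
    linarith
  have hfin : 2 * Real.exp (2 * n * q) * Real.exp (-(2/5 * (n * δ ^ 2)))
      ≤ 3 * Real.exp (-δ ^ 2 * L * n / 32) * (Real.exp (-(n * q)) / 4) := by
    set E := Real.exp (-δ ^ 2 * L * n / 32) * Real.exp (-(n * q)) with hE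
    have hE0 : 0 < E := by positivity
    have h1 : Real.exp (2 * n * q) * Real.exp (-(2/5 * (n * δ ^ 2))) * (8/3) ≤ E := by
      have h2 : (8/3:ℝ) ≤ Real.exp 3 := by linarith [Real.add_one_le_exp (3:ℝ)]
      calc _ ≤ Real.exp (2 * n * q) * Real.exp (-(2/5 * (n * δ ^ 2))) * Real.exp 3 := by gcongr
        _ ≤ E := by
          rw [hE, ← Real.exp_add, ← Real.exp_add, ← Real.exp_add]
          apply Real.exp_le_exp.2
          have h3 := mul_le_mul_of_nonneg_left hδq hn'.le
          have h4 := mul_le_mul_of_nonneg_left hLhi.le hX.le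
          linarith
    have : 3 * Real.exp (-δ ^ 2 * L * n / 32) * (Real.exp (-(n * q)) / 4) = 3 / 4 * E := by
      rw [hE]; ring
    rw [this]; linarith
  have hfin2 : 3 * Real.exp (-δ ^ 2 * L * n / 32) * (Real.exp (-(n * q)) / 4)
      ≤ 3 * Real.exp (-δ ^ 2 * L * n / 32) * SP :=
    mul_le_mul_of_nonneg_left hSPlo (by positivity)
  linarith

/-- Let `k ≥ 60`, `2^k·ln 2 − (1+ln 2) ≤ d ≤ 2^k·ln 2`, and `0 < α ≤ 1/√k`
with `αn = t` a positive integer.  Draw `φ` with a Poisson(`d·n`) number `m` of clauses, the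
clauses i.i.d. uniform, conditioned on `φ` being satisfiable; independently draw a sequence of
`N = ⌈2n²2ⁿ/C(n,αn)⌉` i.i.d. uniform assignments.  Then, with (conditional) probability at
least `1 − e^{−n/(3·ln 2·2^k)} − 3e^{−(1−α)^{2k}·ln 2·n/32}`, some sampled assignment `h` is
within Hamming distance `αn` of a satisfying assignment of `φ` and satisfies at least
`(1−(1−(1−α)^{2k})/(2^k−1))m` clauses of `φ`.  (Expressed below as
`Pr[good ∧ satisfiable] ≥ (1 − δ)·Pr[satisfiable]` over the joint distribution.) -/
theorem true_positive_in_samples_poisson (n k : ℕ) (hn : 0 < n) (hk : 60 ≤ k)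
    (d : ℝ) (hd1 : 2 ^ k * Real.log 2 - (1 + Real.log 2) ≤ d) (hd2 : d ≤ 2 ^ k * Real.log 2)
    (α : ℝ) (hα0 : 0 < α) (hα1 : α ≤ 1 / Real.sqrt k)
    (t : ℕ) (ht0 : 0 < t) (ht : (t : ℝ) = α * n) :
    let N : ℕ := ⌈(2 * (n : ℝ) ^ 2 * 2 ^ n) / (n.choose t : ℝ)⌉₊
    let pois : ℕ → ℝ := fun m => Real.exp (-(d * n)) * (d * n) ^ m / (Nat.factorial m)
    (∑' m : ℕ, pois m *
        (((((univ : Finset (Formula n k m)).filter fun φ =>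
              ∃ a : Assignment n, SatFormula a φ) ×ˢ
              (univ : Finset (Fin N → Assignment n))).filter fun p =>
            ∃ i : Fin N, ∃ a : Assignment n, SatFormula a p.1 ∧
              hammingDist (p.2 i) a ≤ t ∧
              (1 - (1 - (1 - α) ^ (2 * k)) / (2 ^ k - 1)) * m
                ≤ (numSat p.1 (p.2 i) : ℝ)).card : ℝ)
          / ((Fintype.card (Formula n k m) : ℝ) * ((2 : ℝ) ^ n) ^ N))
      ≥ (1 - Real.exp (-(n : ℝ) / (3 * Real.log 2 * 2 ^ k))
          - 3 * Real.exp (-(1 - α) ^ (2 * k) * Real.log 2 * n / 32))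
        * (∑' m : ℕ, pois m *
            (((univ : Finset (Formula n k m)).filter fun φ =>
                ∃ a : Assignment n, SatFormula a φ).card : ℝ)
              / (Fintype.card (Formula n k m) : ℝ)) := by
  intro N pois
  have hn' : (0:ℝ) < n := by exact_mod_cast hn
  have hα13 := alpha_le k hk α hα1
  set δ := (1 - α) ^ k with hδ
  have h7 := one_sub_delta k hk α hα0 hα13
  have hq := delta_q k hk α hα13
  rw [← hδ] at h7 hq
  have hδ0 : 0 < δ := pow_pos (by linarith) k
  have hδ1 : δ < 1 := by linarith
  have hδ2 : (1 - α) ^ (2 * k) = δ ^ 2 := by rw [hδ, ← pow_mul, mul_comm]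
  rw [hδ2]
  have htn : t ≤ n := by
    have : (t:ℝ) ≤ n := by rw [ht]; nlinarith
    exact_mod_cast this
  have htα : (t:ℝ) / n = α := by rw [ht]; field_simp
  set Q : ℝ := (1/2:ℝ)^k with hQ
  have hQ0 : 0 < Q := by positivity
  set K : ℝ := 2 ^ k with hK
  have hQK : Q = 1 / K := by rw [hQ, hK, div_pow, one_pow]
  have hK2 : 2 ≤ K := by
    calc (2:ℝ) = 2 ^ 1 := by norm_num
      _ ≤ K := pow_le_pow_right₀ (by norm_num) (by omega)
  have hK1 : 0 < K - 1 := by linarith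
  set ε := (1 - δ ^ 2) / (K - 1) with hε
  have hε0 : 0 < ε := div_pos (by nlinarith) hK1
  set P : ℕ → ℝ := fun m => (((univ : Finset (Formula n k m)).filter fun φ =>
                ∃ a : Assignment n, SatFormula a φ).card : ℝ)
              / (Fintype.card (Formula n k m) : ℝ) with hP
  set G : ℕ → ℝ := fun m => (((((univ : Finset (Formula n k m)).filter fun φ =>
              ∃ a : Assignment n, SatFormula a φ) ×ˢ
              (univ : Finset (Fin N → Assignment n))).filter fun p =>
            ∃ i : Fin N, ∃ a : Assignment n, SatFormula a p.1 ∧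
              hammingDist (p.2 i) a ≤ t ∧
              (1 - ε) * m
                ≤ (numSat p.1 (p.2 i) : ℝ)).card : ℝ)
          / ((Fintype.card (Formula n k m) : ℝ) * ((2 : ℝ) ^ n) ^ N) with hG
  have eP : (∑' m : ℕ, pois m *
            (((univ : Finset (Formula n k m)).filter fun φ =>
                ∃ a : Assignment n, SatFormula a φ).card : ℝ)
              / (Fintype.card (Formula n k m) : ℝ)) = ∑' m, pois m * P m := by
    refine tsum_congr fun m => ?_
    rw [hP, mul_div_assoc]
  have eG : (∑' m : ℕ, pois m *
        (((((univ : Finset (Formula n k m)).filter fun φ =>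
              ∃ a : Assignment n, SatFormula a φ) ×ˢ
              (univ : Finset (Fin N → Assignment n))).filter fun p =>
            ∃ i : Fin N, ∃ a : Assignment n, SatFormula a p.1 ∧
              hammingDist (p.2 i) a ≤ t ∧
              (1 - ε) * m
                ≤ (numSat p.1 (p.2 i) : ℝ)).card : ℝ)
          / ((Fintype.card (Formula n k m) : ℝ) * ((2 : ℝ) ^ n) ^ N)) = ∑' m, pois m * G m := by
    refine tsum_congr fun m => ?_
    rw [hG, mul_div_assoc]
  rw [eP, eG, ge_iff_le]
  have hM0 : (0:ℝ) < (2 * n) ^ k := by positivity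
  set M : ℝ := (2 * n) ^ k with hM
  have hFc : ∀ m, (Fintype.card (Formula n k m) : ℝ) = M ^ m := by
    intro m
    rw [Fintype.card_fun, card_clause, Fintype.card_fin]
    push_cast; rw [hM]
  have hW0 : (0:ℝ) < ((2:ℝ) ^ n) ^ N := by positivity
  have hWc : (Fintype.card (Fin N → Assignment n) : ℝ) = ((2:ℝ) ^ n) ^ N := by simp
  have hP0 : ∀ m, 0 ≤ P m := fun m => div_nonneg (Nat.cast_nonneg _) (Nat.cast_nonneg _)
  have hG0 : ∀ m, 0 ≤ G m := fun m =>
    div_nonneg (Nat.cast_nonneg _) (mul_nonneg (Nat.cast_nonneg _) hW0.le)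
  have hP1 : ∀ m, P m ≤ 1 := by
    intro m
    apply div_le_one_of_le₀ _ (by positivity)
    exact_mod_cast card_le_univ _
  have hG1 : ∀ m, G m ≤ 1 := by
    intro m
    apply div_le_one_of_le₀ _ (by positivity)
    rw [← hWc, ← Nat.cast_mul, ← Fintype.card_prod]
    exact_mod_cast card_le_univ _
  have hd0 : 0 ≤ d := by
    have hL := Real.log_two_gt_d9
    have hL2 := Real.log_two_lt_d9
    have : (4:ℝ) ≤ K := by
      calc (4:ℝ) = 2 ^ 2 := by norm_num
        _ ≤ K := pow_le_pow_right₀ (by norm_num) (by omega)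
    nlinarith
  have hpos : ∀ m, 0 ≤ pois m := by
    intro m
    show 0 ≤ Real.exp (-(d * n)) * (d * n) ^ m / (Nat.factorial m)
    positivity
  have hSP0 : 0 ≤ ∑' m, pois m * P m := tsum_nonneg fun m => mul_nonneg (hpos m) (hP0 m)
  have hSG0 : 0 ≤ ∑' m, pois m * G m := tsum_nonneg fun m => mul_nonneg (hpos m) (hG0 m)
  have hE1 := Real.exp_pos (-(n:ℝ) / (3 * Real.log 2 * K))
  rcases le_or_gt 1 (3 * Real.exp (-δ ^ 2 * Real.log 2 * n / 32)) with htriv | hnt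
  · refine le_trans ?_ hSG0
    exact mul_nonpos_of_nonpos_of_nonneg (by linarith) hSP0
  have hnδ : 46 ≤ n * δ ^ 2 := by
    by_contra hcon
    push Not at hcon
    have hL2 := Real.log_two_lt_d9
    have hL := Real.log_two_gt_d9
    have h1 : -1 ≤ -δ ^ 2 * Real.log 2 * n / 32 := by
      have : n * δ ^ 2 * Real.log 2 ≤ 46 * 0.6931471808 :=
        mul_le_mul hcon.le hL2.le (by linarith) (by norm_num)
      linarith
    have h2 := Real.exp_le_exp.2 h1
    have h3 : 1 / 3 ≤ Real.exp (-1) := by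
      rw [Real.exp_neg, ← one_div]
      apply one_div_le_one_div_of_le (Real.exp_pos _)
      have := Real.exp_one_lt_d9
      linarith
    linarith
  have hnk : (n:ℝ) ^ k = M * Q := by
    rw [hM, hQ, ← mul_pow]; congr 1; ring
  have hnj : ∀ j : ℕ, j ≤ n → ((n - j : ℕ) : ℝ) ^ k = M * (Q * (1 - (j:ℝ) / n) ^ k) := by
    intro j hj
    rw [hM, hQ, ← mul_pow, ← mul_pow, Nat.cast_sub hj]
    congr 1; field_simp
  set ρ := Real.exp (-(δ / (2 * α) * ((1 - 1 / n) * ε))) *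
      ((1 - Q) + (Real.exp (δ / (2 * α) * α) - 1) / α * (Q * (1 - δ))) with hρ
  have main := poisson_combine n k hn hk d hd1 hd2 Q ρ δ ((1 - δ) / α) hQ pois P G rfl
    hP0 hP1 hG0 hG1 ?_ ?_ ?_ ?_ ?_ hδ0 hδ1 hq hnδ
  · refine le_trans ?_ main
    apply mul_le_mul_of_nonneg_right _ hSP0
    linarith
  · intro l m
    have h := second_moment_count (n := n) (k := k) (m := m) l
    rw [← hM, hnk] at h
    rw [hP]
    show _ ≤ _ / _
    rw [hFc, le_div_iff₀ (by positivity)]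
    refine le_trans (le_of_eq ?_) h
    have e1 : M - M * Q = (1 - Q) * M := by ring
    have e2 : ∑ j ∈ range (n + 1), (n.choose j : ℝ) * (M - 2 * (M * Q) + ((n - j : ℕ) : ℝ) ^ k) ^ m
        = (∑ j ∈ range (n + 1), (n.choose j : ℝ) *
          (1 - 2 * Q + Q * (1 - (j:ℝ) / n) ^ k) ^ m) * M ^ m := by
      rw [sum_mul]
      refine sum_congr rfl fun j hj => ?_
      rw [hnj j (by simpa [Nat.lt_succ_iff] using hj)]
      have e : M - 2 * (M * Q) + M * (Q * (1 - (j:ℝ) / n) ^ k)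
          = (1 - 2 * Q + Q * (1 - (j:ℝ) / n) ^ k) * M := by ring
      rw [e, mul_pow, mul_assoc]
    rw [e1, e2, mul_pow]
    ring
  · intro m
    have h := bad_count (n := n) (k := k) (m := m) t N htn hn ht0 (Nat.le_ceil _) ε (δ / (2 * α))
      hε0 (by positivity)
    rw [← hM, hnk, hnj t htn, htα, ← hδ] at h
    have e1 : M - M * Q = (1 - Q) * M := by ring
    have e2 : Real.exp (-(δ / (2 * α) * ((1 - 1 / n) * ε))) * (M - M * Q +
        (Real.exp (δ / (2 * α) * α) - 1) / α * (M * Q - M * (Q * δ))) = ρ * M := by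
      rw [hρ]; ring
    rw [e2, e1, mul_pow, mul_pow] at h
    have e3 : P m = (((univ : Finset (Formula n k m)).filter fun φ =>
              ∃ a : Assignment n, SatFormula a φ).card : ℝ) * ((2:ℝ) ^ n) ^ N /
              (M ^ m * ((2:ℝ) ^ n) ^ N) := by
      rw [hP]; show _ / _ = _
      rw [hFc, mul_div_mul_right _ _ hW0.ne']
    rw [e3, hG]
    show _ - _ / _ ≤ _
    rw [hFc, ← sub_div, div_le_iff₀ (by positivity)]
    refine h.trans (le_of_eq ?_)
    ring
  · have hnδ' : 40 ≤ n * δ := by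
      have : (n:ℝ) * δ ^ 2 ≤ n * δ := by
        apply mul_le_mul_of_nonneg_left _ hn'.le
        nlinarith
      linarith
    refine (rho_le n K Q α δ hK2 hQK hα0 hδ0 hδ1 hnδ' hn).trans (le_of_eq ?_)
    congr 3
    rw [hQK]
    have : 1 - 1 / K = (K - 1) / K := by field_simp
    rw [this]
    field_simp
  · rw [le_div_iff₀ hα0]; exact h7
  · rw [div_le_iff₀ hα0]
    have := one_add_mul_le_pow (a := -α) (by linarith) k
    rw [← sub_eq_add_neg] at this
    rw [hδ]
    linarith
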